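/- Let G be a subgroup of S_n with ℓ-local base T and let μ ∈ M_T. Then for all probability measures ν₁, ν₂ on G, T̃₂(ν₂|ν₁) ≤ 2 c² K_n · ( √H(ν₁|μ) + √H(ν₂|μ) )², where c = min(2ℓ−1, n) and T̃₂ is the weak transport cost for the Hamming distance d_H. -/

import Mathlib

attribute [local instance] Classical.propDecidable

noncomputable section

/-- Hamming distance on permutations, as a real number. -/
noncomputable def dH {n : ℕ} (σ τ : Equiv.Perm (Fin n)) : ℝ :=
  ((Finset.univ.filter fun i => σ i ≠ τ i).card : ℝ)

/-- Degree (cardinality of the support) of a permutation. -/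
noncomputable def degree {n : ℕ} (σ : Equiv.Perm (Fin n)) : ℕ :=
  (Finset.univ.filter fun i => σ i ≠ i).card

/-- The subgroup `G_j` of elements of `G` fixing every index `> j`. -/
def Gj {n : ℕ} (G : Subgroup (Equiv.Perm (Fin n))) (j : Fin n) :
    Set (Equiv.Perm (Fin n)) :=
  {σ | σ ∈ G ∧ ∀ i : Fin n, j < i → σ i = i}

/-- The orbit `O_j` of `j` under `G_j`. -/
def Orb {n : ℕ} (G : Subgroup (Equiv.Perm (Fin n))) (j : Fin n) : Set (Fin n) :=
  {i | ∃ σ ∈ Gj G j, σ j = i}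

/-- An `ℓ`-local base of `G`. -/
def IsLocalBase {n : ℕ} (ℓ : ℕ) (G : Subgroup (Equiv.Perm (Fin n)))
    (t : Fin n → Fin n → Equiv.Perm (Fin n)) : Prop :=
  ∀ j : Fin n, (j : ℕ) ≠ 0 →
    t j j = 1 ∧ ∀ i ∈ Orb G j, i ≠ j →
      t i j ∈ Gj G j ∧ t i j i = j ∧ degree (t i j) ≤ ℓ

/-- The map `U_T (i_2, …, i_n) = t_{i_2,2} t_{i_3,3} ⋯ t_{i_n,n}`. -/
noncomputable def UT {n : ℕ} (t : Fin n → Fin n → Equiv.Perm (Fin n))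
    (i : Fin n → Fin n) : Equiv.Perm (Fin n) :=
  (((List.finRange n).drop 1).map fun j => t (i j) j).prod

/-- `μ` belongs to the class `M_T`: it is the pushforward under `U_T` of a product
of probability measures on the orbits `O_j`. -/
def MemMT {n : ℕ} (G : Subgroup (Equiv.Perm (Fin n)))
    (t : Fin n → Fin n → Equiv.Perm (Fin n)) (μ : Equiv.Perm (Fin n) → ℝ) : Prop :=
  ∃ νh : Fin n → Fin n → ℝ,
    (∀ j : Fin n,
      (∀ i, 0 ≤ νh j i) ∧ (∀ i, i ∉ Orb G j → νh j i = 0) ∧ ∑ i, νh j i = 1) ∧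
    ∀ σ, μ σ = ∑ i : Fin n → Fin n, if UT t i = σ then ∏ j, νh j (i j) else 0

/-- `K_n`, the number of indices `j ∈ {2, …, n}` with `O_j ≠ {j}`. -/
noncomputable def Kn {n : ℕ} (G : Subgroup (Equiv.Perm (Fin n))) : ℕ :=
  (Finset.univ.filter fun j : Fin n => (j : ℕ) ≠ 0 ∧ Orb G j ≠ {j}).card

/-- Relative entropy `H(ν | μ)` of finitely supported densities; `+∞` if `ν` is not
absolutely continuous with respect to `μ`. -/
noncomputable def relEnt {X : Type*} [Fintype X] (ν μ : X → ℝ) : ENNReal :=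
  if ∀ x, μ x = 0 → ν x = 0 then
    ENNReal.ofReal (∑ x, ν x * Real.log (ν x / μ x))
  else ⊤

/-- `p` is a probability measure supported on the set `S`. -/
def IsProbOn {X : Type*} [Fintype X] (p : X → ℝ) (S : Set X) : Prop :=
  (∀ x, 0 ≤ p x) ∧ (∀ x, x ∉ S → p x = 0) ∧ ∑ x, p x = 1

/-- The weak transport cost `̃T₂(ν₂ | ν₁)` for the cost `d` (kernel formulation,
`π(x, y) = ν₁(x) p_x(y)`). -/
noncomputable def tT2 {X : Type*} [Fintype X] (d : X → X → ℝ) (ν₁ ν₂ : X → ℝ) : ℝ :=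
  sInf {w | ∃ p : X → X → ℝ,
    (∀ x y, 0 ≤ p x y) ∧ (∀ x, ∑ y, p x y = 1) ∧ (∀ y, ∑ x, ν₁ x * p x y = ν₂ y) ∧
    w = ∑ x, ν₁ x * (∑ y, p x y * d x y) ^ 2}

/-- The relative entropy `∑ x, ν x * log (ν x / μ x)` as a real number. -/
def klSum {X : Type*} [Fintype X] (ν μ : X → ℝ) : ℝ :=
  ∑ x, ν x * Real.log (ν x / μ x)

/-- `p` is a Markov kernel transporting `ν₁` to `ν₂`. -/
structure IsTransport {X : Type*} [Fintype X] (ν₁ ν₂ : X → ℝ) (p : X → X → ℝ) : Prop where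
  nonneg : ∀ x y, 0 ≤ p x y
  sum_eq_one : ∀ x, ∑ y, p x y = 1
  marginal : ∀ y, ∑ x, ν₁ x * p x y = ν₂ y

/-- The weak transport-entropy inequality with constants `a`, `b` for the reference measure `μ`
and the family of costs `d`. -/
def WeakTransportIneq {X ι : Type*} [Fintype X] [Fintype ι] (a b : ℝ) (μ : X → ℝ)
    (d : ι → X → X → ℝ) : Prop :=
  ∀ ν₁ ∈ stdSimplex ℝ X, ∀ ν₂ ∈ stdSimplex ℝ X,
    (∀ x, μ x = 0 → ν₁ x = 0) → (∀ x, μ x = 0 → ν₂ x = 0) →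
    ∃ p, IsTransport ν₁ ν₂ p ∧
      ∑ x, ν₁ x * ∑ i, (∑ y, p x y * d i x y) ^ 2 ≤ a * klSum ν₁ μ + b * klSum ν₂ μ

/-! ### Scalar inequalities -/

lemma log_lower_bound_of_le_one {u : ℝ} (hu : 0 < u) (hu1 : u ≤ 1) :
    (1 - u) ^ 2 / 2 ≤ u * Real.log u - u + 1 := by
  have hinv : 1 ≤ u⁻¹ := (one_le_inv₀ hu).2 hu1
  have h := Real.self_le_sinh_iff.2 (Real.log_nonneg hinv)
  rw [Real.sinh_log (by positivity), Real.log_inv, inv_inv] at h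
  have h2 := mul_le_mul_of_nonneg_left h hu.le
  have h3 : u * ((u⁻¹ - u) / 2) = (1 - u ^ 2) / 2 := by field_simp
  nlinarith

lemma log_lower_bound_of_one_le {u : ℝ} (hu : 1 ≤ u) :
    (u - 1) ^ 2 / (2 * u) ≤ u * Real.log u - u + 1 := by
  have hu0 : 0 < u := by linarith
  have hx0 : 0 ≤ 1 - u⁻¹ := by linarith [inv_le_one_of_one_le₀ hu]
  have hx1 : 1 - u⁻¹ < 1 := by linarith [inv_pos.2 hu0]
  have h := sum_le_hasSum (Finset.range 2) (fun i _ => by positivity)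
    (Real.hasSum_pow_div_log_of_abs_lt_one (abs_lt.2 ⟨by linarith, hx1⟩))
  simp only [Finset.sum_range_succ, Finset.sum_range_zero, sub_sub_cancel, Real.log_inv,
    neg_neg] at h
  norm_num at h
  have h2 := mul_le_mul_of_nonneg_left h hu0.le
  have h3 : u * (1 - u⁻¹ + (1 - u⁻¹) ^ 2 / 2) = u - 1 + (u - 1) ^ 2 / (2 * u) := by field_simp
  linarith

/-- The integrand of the relative entropy, with the linear part removed. -/
def entropyGap (a m : ℝ) : ℝ := a * Real.log (a / m) - a + m

lemma sq_div_le_entropyGap_of_le {b m : ℝ} (hb : 0 ≤ b) (hm : 0 < m) (hbm : b ≤ m) :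
    (m - b) ^ 2 / m ≤ 2 * entropyGap b m := by
  unfold entropyGap
  rcases hb.eq_or_lt with rfl | hb
  · simp only [sub_zero, zero_div, Real.log_zero, mul_zero, zero_add]
    rw [div_le_iff₀ hm]; nlinarith
  have h := log_lower_bound_of_le_one (div_pos hb hm) ((div_le_one hm).2 hbm)
  have h2 := mul_le_mul_of_nonneg_left h hm.le
  have h3 : m * ((1 - b / m) ^ 2 / 2) = (m - b) ^ 2 / m / 2 := by field_simp
  have h4 : m * (b / m * Real.log (b / m) - b / m + 1) = b * Real.log (b / m) - b + m := by
    field_simp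
  linarith

lemma sq_div_le_entropyGap_of_ge {a m : ℝ} (hm : 0 < m) (ham : m ≤ a) :
    (a - m) ^ 2 / a ≤ 2 * entropyGap a m := by
  unfold entropyGap
  have ha : 0 < a := hm.trans_le ham
  have h := log_lower_bound_of_one_le ((one_le_div hm).2 ham)
  have h2 := mul_le_mul_of_nonneg_left h hm.le
  have h3 : m * ((a / m - 1) ^ 2 / (2 * (a / m))) = (a - m) ^ 2 / a / 2 := by field_simp
  have h4 : m * (a / m * Real.log (a / m) - a / m + 1) = a * Real.log (a / m) - a + m := by
    field_simp
  linarith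

lemma entropyGap_nonneg {a m : ℝ} (ha : 0 ≤ a) (hm : 0 < m) : 0 ≤ entropyGap a m := by
  rcases le_total a m with h | h
  · have := sq_div_le_entropyGap_of_le ha hm h
    have : 0 ≤ (m - a) ^ 2 / m := by positivity
    linarith
  · have := sq_div_le_entropyGap_of_ge hm h
    have : 0 ≤ (a - m) ^ 2 / a := by positivity
    linarith

lemma sq_sub_div_le_entropyGap {a b m θ : ℝ} (ha : 0 < a) (hb : 0 ≤ b) (hm : 0 < m)
    (hθ : 0 < θ) (hba : b ≤ a) :
    (a - b) ^ 2 / a ≤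
      2 * (1 + θ) * entropyGap a m + 2 * (1 + θ⁻¹) * entropyGap b m := by
  have hga := entropyGap_nonneg ha.le hm
  have hgb := entropyGap_nonneg hb hm
  have hθi : 0 < θ⁻¹ := inv_pos.2 hθ
  have hA : 0 ≤ θ * entropyGap a m := by positivity
  have hB : 0 ≤ θ⁻¹ * entropyGap b m := by positivity
  rcases le_total m b with hmb | hmb
  · have h1 := sq_div_le_entropyGap_of_ge hm (hmb.trans hba)
    have h2 : (a - b) ^ 2 / a ≤ (a - m) ^ 2 / a := by
      have : 0 ≤ a - b := by linarith
      gcongr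
    nlinarith
  rcases le_total a m with ham | ham
  · have h1 := sq_div_le_entropyGap_of_le hb hm hmb
    have h2 : (a - b) ^ 2 / a ≤ (m - b) ^ 2 / m := by
      rw [div_le_div_iff₀ ha hm]
      have : 0 ≤ a * m - b ^ 2 := by nlinarith
      nlinarith [mul_nonneg (sub_nonneg.2 ham) this]
    nlinarith
  · have h1 := sq_div_le_entropyGap_of_ge hm ham
    have h2 := sq_div_le_entropyGap_of_le hb hm hmb
    have h3 : (m - b) ^ 2 / a ≤ (m - b) ^ 2 / m := by gcongr
    have h4 : (a - b) ^ 2 ≤ (1 + θ) * (a - m) ^ 2 + (1 + θ⁻¹) * (m - b) ^ 2 := by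
      have h5 : (1 + θ) * (a - m) ^ 2 + (1 + θ⁻¹) * (m - b) ^ 2 - (a - b) ^ 2
          = θ⁻¹ * (θ * (a - m) - (m - b)) ^ 2 := by field_simp; ring
      have : 0 ≤ θ⁻¹ * (θ * (a - m) - (m - b)) ^ 2 := by positivity
      linarith
    have h6 : (a - b) ^ 2 / a ≤ (1 + θ) * ((a - m) ^ 2 / a) + (1 + θ⁻¹) * ((m - b) ^ 2 / a) := by
      rw [← mul_div_assoc, ← mul_div_assoc, ← add_div]
      gcongr
    have h7 := mul_le_mul_of_nonneg_left h1 (show 0 ≤ 1 + θ by positivity)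
    have h8 := mul_le_mul_of_nonneg_left (h3.trans h2) (show 0 ≤ 1 + θ⁻¹ by positivity)
    linarith

lemma le_sq_sqrt_add_sqrt {w x y : ℝ} (hx : 0 ≤ x) (hy : 0 ≤ y)
    (h : ∀ θ : ℝ, 0 < θ → w ≤ (1 + θ) * x + (1 + θ⁻¹) * y) :
    w ≤ (√x + √y) ^ 2 := by
  rcases hx.eq_or_lt with rfl | hx
  · rw [Real.sqrt_zero, zero_add, Real.sq_sqrt hy]
    refine le_of_forall_pos_le_add fun ε hε => ?_
    refine (h ((y + 1) / ε) (by positivity)).trans ?_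
    rw [inv_div, mul_zero, zero_add, one_add_mul, div_mul_eq_mul_div]
    gcongr
    rw [div_le_iff₀ (by positivity)]
    nlinarith
  rcases hy.eq_or_lt with rfl | hy
  · rw [Real.sqrt_zero, add_zero, Real.sq_sqrt hx.le]
    refine le_of_forall_pos_le_add fun ε hε => ?_
    refine (h (ε / x) (by positivity)).trans (le_of_eq ?_)
    field_simp
    ring
  · have hsx := Real.sqrt_pos.2 hx
    have hsy := Real.sqrt_pos.2 hy
    refine (h (√y / √x) (by positivity)).trans (le_of_eq ?_)
    have h1 : √y / √x * x = √x * √y := by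
      rw [div_mul_eq_mul_div, div_eq_iff hsx.ne']
      nlinarith [Real.sq_sqrt hx.le]
    have h2 : √x / √y * y = √x * √y := by
      rw [div_mul_eq_mul_div, div_eq_iff hsy.ne']
      nlinarith [Real.sq_sqrt hy.le]
    rw [inv_div, one_add_mul, one_add_mul, h1, h2, add_sq, Real.sq_sqrt hx.le, Real.sq_sqrt hy.le]
    ring

/-! ### Transport on a finite space -/

lemma sum_entropyGap {X : Type*} [Fintype X] {ν μ : X → ℝ} (hν : ν ∈ stdSimplex ℝ X)
    (hμ : μ ∈ stdSimplex ℝ X) : ∑ x, entropyGap (ν x) (μ x) = klSum ν μ := by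
  simp [entropyGap, klSum, Finset.sum_add_distrib, hν.2, hμ.2]

lemma klSum_nonneg {X : Type*} [Fintype X] {ν μ : X → ℝ} (hν : ν ∈ stdSimplex ℝ X)
    (hμ : μ ∈ stdSimplex ℝ X) (hac : ∀ x, μ x = 0 → ν x = 0) : 0 ≤ klSum ν μ := by
  rw [← sum_entropyGap hν hμ]
  refine Finset.sum_nonneg fun x _ => ?_
  rcases (hμ.1 x).eq_or_lt with h | h
  · simp [entropyGap, hac x h.symm, ← h]
  · exact entropyGap_nonneg (hν.1 x) h

lemma sq_sum_mul_le {X : Type*} [Fintype X] {w : X → ℝ} (hw : w ∈ stdSimplex ℝ X) (f : X → ℝ) :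
    (∑ x, w x * f x) ^ 2 ≤ ∑ x, w x * f x ^ 2 :=
  Real.pow_arith_mean_le_arith_mean_pow_of_even Finset.univ w f (fun x _ => hw.1 x) hw.2 even_two

lemma IsTransport.mul_apply_eq_zero {X : Type*} [Fintype X] {ν₁ ν₂ : X → ℝ} {p : X → X → ℝ}
    (hp : IsTransport ν₁ ν₂ p) (hν₁ : ∀ x, 0 ≤ ν₁ x) {y : X} (hy : ν₂ y = 0) (x : X) :
    ν₁ x * p x y = 0 := by
  have h := hp.marginal y
  rw [hy, Finset.sum_eq_zero_iff_of_nonneg fun x _ => mul_nonneg (hν₁ x) (hp.nonneg x y)] at h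
  exact h x (Finset.mem_univ x)

/-- The optimal coupling for the discrete metric. -/
lemma exists_isTransport_discrete {X : Type*} [Fintype X] {ν₁ ν₂ : X → ℝ}
    (hν₁ : ν₁ ∈ stdSimplex ℝ X) (hν₂ : ν₂ ∈ stdSimplex ℝ X) :
    ∃ p, IsTransport ν₁ ν₂ p ∧
      ∀ x, ν₁ x * ∑ y, p x y * (if x = y then 0 else 1) = max (ν₁ x - ν₂ x) 0 := by
  set D : ℝ := ∑ x, max (ν₁ x - ν₂ x) 0 with hD
  have hD' : ∑ x, max (ν₂ x - ν₁ x) 0 = D := by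
    rw [← sub_eq_zero, hD, ← Finset.sum_sub_distrib]
    have h : ∀ x, max (ν₂ x - ν₁ x) 0 - max (ν₁ x - ν₂ x) 0 = ν₂ x - ν₁ x := fun x => by
      rcases le_total (ν₁ x) (ν₂ x) with h | h
      · rw [max_eq_left (by linarith), max_eq_right (by linarith)]; ring
      · rw [max_eq_right (by linarith), max_eq_left (by linarith)]; ring
    rw [Finset.sum_congr rfl fun x _ => h x, Finset.sum_sub_distrib, hν₁.2, hν₂.2, sub_self]
  have hDdiv : ∀ x, max (ν₁ x - ν₂ x) 0 * D / D = max (ν₁ x - ν₂ x) 0 := fun x => by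
    by_cases h : D = 0
    · have h0 := (Finset.sum_eq_zero_iff_of_nonneg fun x _ => le_max_right (ν₁ x - ν₂ x) 0).1
        (hD.symm.trans h) x (Finset.mem_univ x)
      simp [h0]
    · exact mul_div_cancel_right₀ _ h
  have hDdiv' : ∀ x, D * max (ν₂ x - ν₁ x) 0 / D = max (ν₂ x - ν₁ x) 0 := fun x => by
    by_cases h : D = 0
    · have h0 := (Finset.sum_eq_zero_iff_of_nonneg fun x _ => le_max_right (ν₂ x - ν₁ x) 0).1
        (hD'.trans h) x (Finset.mem_univ x)
      simp [h0]
    · exact mul_div_cancel_left₀ _ h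
  have hD0 : 0 ≤ D := Finset.sum_nonneg fun x _ => le_max_right _ _
  have hminmax : ∀ x, min (ν₁ x) (ν₂ x) + max (ν₁ x - ν₂ x) 0 = ν₁ x := fun x => by
    rcases le_total (ν₁ x) (ν₂ x) with h | h
    · rw [min_eq_left h, max_eq_right (by linarith), add_zero]
    · rw [min_eq_right h, max_eq_left (by linarith)]; ring
  have hminmax' : ∀ x, min (ν₁ x) (ν₂ x) + max (ν₂ x - ν₁ x) 0 = ν₂ x := fun x => by
    rcases le_total (ν₁ x) (ν₂ x) with h | h
    · rw [min_eq_left h, max_eq_left (by linarith)]; ring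
    · rw [min_eq_right h, max_eq_right (by linarith), add_zero]
  let q : X → X → ℝ := fun x y =>
    (if x = y then min (ν₁ x) (ν₂ x) else 0) + max (ν₁ x - ν₂ x) 0 * max (ν₂ y - ν₁ y) 0 / D
  have hq0 : ∀ x y, 0 ≤ q x y := fun x y => by
    refine add_nonneg ?_ (by positivity)
    split_ifs
    exacts [le_min (hν₁.1 x) (hν₂.1 x), le_rfl]
  have hq1 : ∀ x, ∑ y, q x y = ν₁ x := fun x => by
    simp only [q]
    rw [Finset.sum_add_distrib, Finset.sum_ite_eq, if_pos (Finset.mem_univ x), ← Finset.sum_div,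
      ← Finset.mul_sum, hD', hDdiv, hminmax]
  have hq2 : ∀ y, ∑ x, q x y = ν₂ y := fun y => by
    simp only [q]
    rw [Finset.sum_add_distrib, Finset.sum_ite_eq', if_pos (Finset.mem_univ y), ← Finset.sum_div,
      ← Finset.sum_mul, ← hD, hDdiv', hminmax']
  have hqd : ∀ x, ∑ y, q x y * (if x = y then 0 else 1) = max (ν₁ x - ν₂ x) 0 := fun x => by
    have h : ∀ y, q x y * (if x = y then 0 else 1)
        = max (ν₁ x - ν₂ x) 0 * max (ν₂ y - ν₁ y) 0 / D := fun y => by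
      by_cases hxy : x = y
      · subst hxy
        rcases le_total (ν₁ x) (ν₂ x) with h | h
        · simp [max_eq_right (sub_nonpos.2 h)]
        · simp [max_eq_right (sub_nonpos.2 h)]
      · simp [q, hxy]
    rw [Finset.sum_congr rfl fun y _ => h y, ← Finset.sum_div, ← Finset.mul_sum, hD', hDdiv]
  let p : X → X → ℝ := fun x y => if ν₁ x = 0 then ν₂ y else q x y / ν₁ x
  have hpq : ∀ x y, ν₁ x * p x y = q x y := fun x y => by
    by_cases h : ν₁ x = 0
    · have h0 := (Finset.sum_eq_zero_iff_of_nonneg fun y _ => hq0 x y).1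
        ((hq1 x).trans h) y (Finset.mem_univ y)
      rw [h, h0, zero_mul]
    · simp only [p, if_neg h]
      exact mul_div_cancel₀ _ h
  refine ⟨p, ⟨fun x y => ?_, fun x => ?_, fun y => ?_⟩, fun x => ?_⟩
  · simp only [p]
    split_ifs
    exacts [hν₂.1 y, div_nonneg (hq0 x y) (hν₁.1 x)]
  · by_cases h : ν₁ x = 0
    · simp only [p, if_pos h, hν₂.2]
    · simp only [p, if_neg h]
      rw [← Finset.sum_div, hq1, div_self h]
  · simp only [hpq, hq2]
  · rw [Finset.mul_sum]
    simp only [← mul_assoc, hpq, hqd]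

/-- The weak transport-entropy inequality for the discrete metric on one factor. -/
lemma weakTransportIneq_discrete {X : Type*} [Fintype X] {θ : ℝ} (hθ : 0 < θ) {μ : X → ℝ}
    (hμ : μ ∈ stdSimplex ℝ X) :
    WeakTransportIneq (2 * (1 + θ)) (2 * (1 + θ⁻¹)) μ
      (fun (_ : Unit) x y => if x = y then (0 : ℝ) else 1) := by
  intro ν₁ hν₁ ν₂ hν₂ hac₁ hac₂
  obtain ⟨p, hp, hpd⟩ := exists_isTransport_discrete hν₁ hν₂
  refine ⟨p, hp, ?_⟩
  rw [← sum_entropyGap hν₁ hμ, ← sum_entropyGap hν₂ hμ, Finset.mul_sum, Finset.mul_sum,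
    ← Finset.sum_add_distrib]
  refine Finset.sum_le_sum fun x _ => ?_
  rw [Finset.univ_unique, Finset.sum_singleton]
  have hθi : 0 < θ⁻¹ := inv_pos.2 hθ
  rcases (hμ.1 x).eq_or_lt with hm | hm
  · simp [hac₁ x hm.symm, hac₂ x hm.symm, ← hm, entropyGap]
  have h1 := entropyGap_nonneg (hν₁.1 x) hm
  have h2 := entropyGap_nonneg (hν₂.1 x) hm
  rcases (hν₁.1 x).eq_or_lt with ha | ha
  · rw [← ha, zero_mul]
    rw [← ha] at h1
    positivity
  have h3 : ν₁ x * (∑ y, p x y * (if x = y then 0 else 1)) ^ 2 = max (ν₁ x - ν₂ x) 0 ^ 2 / ν₁ x := by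
    rw [← hpd x]
    field_simp
  rw [h3]
  rcases le_total (ν₂ x) (ν₁ x) with h | h
  · rw [max_eq_left (by linarith)]
    exact sq_sub_div_le_entropyGap ha (hν₂.1 x) hm hθ h
  · rw [max_eq_right (by linarith)]
    simp only [ne_eq, OfNat.ofNat_ne_zero, not_false_eq_true, zero_pow, zero_div]
    positivity

/-! ### Tensorization -/

/-- The first marginal of a density on a product. -/
def margFst {X Y : Type*} [Fintype Y] (ν : X × Y → ℝ) (x : X) : ℝ := ∑ y, ν (x, y)

/-- The conditional density of the second coordinate given the first, with the default value `μ`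
where the first marginal vanishes. -/
def condSnd {X Y : Type*} [Fintype Y] (ν : X × Y → ℝ) (μ : Y → ℝ) (x : X) (y : Y) : ℝ :=
  if margFst ν x = 0 then μ y else ν (x, y) / margFst ν x

section Tensorization

variable {X Y : Type*} [Fintype Y]

lemma margFst_eq_zero {ν : X × Y → ℝ} {μ : X → ℝ} {μ' : Y → ℝ}
    (hac : ∀ z : X × Y, μ z.1 * μ' z.2 = 0 → ν z = 0) (x : X) (hx : μ x = 0) :
    margFst ν x = 0 :=
  Finset.sum_eq_zero fun y _ => hac (x, y) (by simp [hx])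

lemma condSnd_eq_zero {ν : X × Y → ℝ} {μ : X → ℝ} {μ' : Y → ℝ}
    (hac : ∀ z : X × Y, μ z.1 * μ' z.2 = 0 → ν z = 0) (x : X) (y : Y) (hy : μ' y = 0) :
    condSnd ν μ' x y = 0 := by
  unfold condSnd
  split_ifs
  · exact hy
  · rw [hac (x, y) (by simp [hy]), zero_div]

variable [Fintype X]

lemma margFst_mem_stdSimplex {ν : X × Y → ℝ} (hν : ν ∈ stdSimplex ℝ (X × Y)) :
    margFst ν ∈ stdSimplex ℝ X :=
  ⟨fun x => Finset.sum_nonneg fun y _ => hν.1 (x, y), by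
    rw [← hν.2, Fintype.sum_prod_type]; rfl⟩

lemma margFst_mul_condSnd {ν : X × Y → ℝ} (hν : ν ∈ stdSimplex ℝ (X × Y)) (μ : Y → ℝ)
    (x : X) (y : Y) : margFst ν x * condSnd ν μ x y = ν (x, y) := by
  unfold condSnd
  split_ifs with h
  · rw [h, zero_mul]
    exact ((Finset.sum_eq_zero_iff_of_nonneg fun y _ => hν.1 (x, y)).1 h y
      (Finset.mem_univ y)).symm
  · exact mul_div_cancel₀ _ h

lemma condSnd_mem_stdSimplex {ν : X × Y → ℝ} (hν : ν ∈ stdSimplex ℝ (X × Y)) {μ : Y → ℝ}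
    (hμ : μ ∈ stdSimplex ℝ Y) (x : X) : condSnd ν μ x ∈ stdSimplex ℝ Y := by
  by_cases h : margFst ν x = 0
  · have : condSnd ν μ x = μ := funext fun y => if_pos h
    rwa [this]
  · have : condSnd ν μ x = fun y => ν (x, y) / margFst ν x := funext fun y => if_neg h
    rw [this]
    refine ⟨fun y => div_nonneg (hν.1 _) ((margFst_mem_stdSimplex hν).1 x), ?_⟩
    rw [← Finset.sum_div]
    exact div_self h

lemma klSum_prod {ν : X × Y → ℝ} (hν : ν ∈ stdSimplex ℝ (X × Y)) {μ : X → ℝ} {μ' : Y → ℝ}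
    (hac : ∀ z : X × Y, μ z.1 * μ' z.2 = 0 → ν z = 0) :
    klSum ν (fun z => μ z.1 * μ' z.2) =
      klSum (margFst ν) μ + ∑ x, margFst ν x * klSum (condSnd ν μ' x) μ' := by
  unfold klSum
  rw [Fintype.sum_prod_type, ← Finset.sum_add_distrib]
  refine Finset.sum_congr rfl fun x _ => ?_
  have h1 : margFst ν x * Real.log (margFst ν x / μ x) =
      ∑ y, ν (x, y) * Real.log (margFst ν x / μ x) := (Finset.sum_mul ..)
  rw [h1, Finset.mul_sum, ← Finset.sum_add_distrib]
  refine Finset.sum_congr rfl fun y _ => ?_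
  rw [← mul_assoc, margFst_mul_condSnd hν, ← mul_add]
  by_cases h0 : ν (x, y) = 0
  · simp [h0]
  have hz : μ x * μ' y ≠ 0 := fun h => h0 (hac (x, y) h)
  have hm : margFst ν x * condSnd ν μ' x y ≠ 0 := by rwa [margFst_mul_condSnd hν]
  rw [← Real.log_mul (div_ne_zero (left_ne_zero_of_mul hm) (left_ne_zero_of_mul hz))
    (div_ne_zero (right_ne_zero_of_mul hm) (right_ne_zero_of_mul hz)), div_mul_div_comm,
    margFst_mul_condSnd hν]

variable {ι κ : Type*} [Fintype ι] [Fintype κ]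

lemma WeakTransportIneq.prod {a b : ℝ} {μ : X → ℝ} {μ' : Y → ℝ} {d : ι → X → X → ℝ}
    {d' : κ → Y → Y → ℝ} (hμ' : μ' ∈ stdSimplex ℝ Y)
    (h : WeakTransportIneq a b μ d) (h' : WeakTransportIneq a b μ' d') :
    WeakTransportIneq a b (fun z : X × Y => μ z.1 * μ' z.2)
      (Sum.elim (fun i z w => d i z.1 w.1) (fun j z w => d' j z.2 w.2)) := by
  intro ν₁ hν₁ ν₂ hν₂ hac₁ hac₂
  obtain ⟨p, hp, hpd⟩ := h _ (margFst_mem_stdSimplex hν₁) _ (margFst_mem_stdSimplex hν₂)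
    (margFst_eq_zero hac₁) (margFst_eq_zero hac₂)
  choose q hq hqd using fun x x' => h' _ (condSnd_mem_stdSimplex hν₁ hμ' x)
    _ (condSnd_mem_stdSimplex hν₂ hμ' x') (condSnd_eq_zero hac₁ x) (condSnd_eq_zero hac₂ x')
  refine ⟨fun z w => p z.1 w.1 * q z.1 w.1 z.2 w.2,
    ⟨fun z w => mul_nonneg (hp.nonneg _ _) ((hq _ _).nonneg _ _), fun z => ?_, fun w => ?_⟩, ?_⟩
  · rw [Fintype.sum_prod_type]
    simp only [← Finset.mul_sum, (hq _ _).sum_eq_one, mul_one, hp.sum_eq_one]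
  · rw [Fintype.sum_prod_type, ← margFst_mul_condSnd hν₂ μ', ← hp.marginal, Finset.sum_mul]
    refine Finset.sum_congr rfl fun x _ => ?_
    rw [← (hq x w.1).marginal, Finset.mul_sum]
    refine Finset.sum_congr rfl fun y _ => ?_
    rw [← margFst_mul_condSnd hν₁ μ']
    ring
  · have hfst : ∀ (x : X) (y : Y) (i : ι),
        ∑ w : X × Y, p x w.1 * q x w.1 y w.2 * d i x w.1 = ∑ x', p x x' * d i x x' := by
      intro x y i
      rw [Fintype.sum_prod_type]
      refine Finset.sum_congr rfl fun x' _ => ?_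
      simp only [← Finset.sum_mul, ← Finset.mul_sum, (hq _ _).sum_eq_one, mul_one]
    have hsnd : ∀ (x : X) (y : Y) (j : κ),
        (∑ w : X × Y, p x w.1 * q x w.1 y w.2 * d' j y w.2) ^ 2 ≤
          ∑ x', p x x' * (∑ y', q x x' y y' * d' j y y') ^ 2 := by
      intro x y j
      refine le_trans (le_of_eq ?_) (sq_sum_mul_le ⟨hp.nonneg x, hp.sum_eq_one x⟩ _)
      rw [Fintype.sum_prod_type]
      simp only [mul_assoc, ← Finset.mul_sum]
    have hmass : ∀ x, ∑ y, ν₁ (x, y) = margFst ν₁ x := fun x => rfl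
    have hcost : ∑ z, ν₁ z * ∑ k : ι ⊕ κ, (∑ w : X × Y, p z.1 w.1 * q z.1 w.1 z.2 w.2 *
          (Sum.elim (fun i z w => d i z.1 w.1) (fun j z w => d' j z.2 w.2) k : X × Y → X × Y → ℝ)
            z w) ^ 2
        ≤ ∑ x, margFst ν₁ x * ∑ i, (∑ x', p x x' * d i x x') ^ 2
          + ∑ x, ∑ x', margFst ν₁ x * p x x' *
            ∑ y, condSnd ν₁ μ' x y * ∑ j, (∑ y', q x x' y y' * d' j y y') ^ 2 := by
      rw [Fintype.sum_prod_type, ← Finset.sum_add_distrib]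
      refine Finset.sum_le_sum fun x _ => ?_
      simp only [Fintype.sum_sum_type, Sum.elim_inl, Sum.elim_inr, hfst, mul_add,
        Finset.sum_add_distrib]
      rw [← Finset.sum_mul, hmass]
      gcongr
      calc ∑ y, ν₁ (x, y) * ∑ j, (∑ w : X × Y, p x w.1 * q x w.1 y w.2 * d' j y w.2) ^ 2
          ≤ ∑ y, ν₁ (x, y) * ∑ j, ∑ x', p x x' * (∑ y', q x x' y y' * d' j y y') ^ 2 := by
            refine Finset.sum_le_sum fun y _ => mul_le_mul_of_nonneg_left ?_ (hν₁.1 _)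
            exact Finset.sum_le_sum fun j _ => hsnd x y j
        _ = ∑ y, ∑ x', margFst ν₁ x * p x x' *
              (condSnd ν₁ μ' x y * ∑ j, (∑ y', q x x' y y' * d' j y y') ^ 2) := by
            refine Finset.sum_congr rfl fun y _ => ?_
            rw [Finset.sum_comm, Finset.mul_sum]
            refine Finset.sum_congr rfl fun x' _ => ?_
            rw [← Finset.mul_sum, ← margFst_mul_condSnd hν₁ μ']
            ring
        _ = _ := by
            rw [Finset.sum_comm]
            simp only [Finset.mul_sum]
    have hfib : ∑ x, ∑ x', margFst ν₁ x * p x x' *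
            ∑ y, condSnd ν₁ μ' x y * ∑ j, (∑ y', q x x' y y' * d' j y y') ^ 2
        ≤ a * ∑ x, margFst ν₁ x * klSum (condSnd ν₁ μ' x) μ'
          + b * ∑ x, margFst ν₂ x * klSum (condSnd ν₂ μ' x) μ' := by
      calc _ ≤ ∑ x, ∑ x', margFst ν₁ x * p x x' * (a * klSum (condSnd ν₁ μ' x) μ'
              + b * klSum (condSnd ν₂ μ' x') μ') := by
            refine Finset.sum_le_sum fun x _ => Finset.sum_le_sum fun x' _ => ?_
            exact mul_le_mul_of_nonneg_left (hqd x x')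
              (mul_nonneg ((margFst_mem_stdSimplex hν₁).1 x) (hp.nonneg x x'))
        _ = _ := by
            simp only [mul_add, Finset.sum_add_distrib]
            congr 1
            · rw [Finset.mul_sum]
              refine Finset.sum_congr rfl fun x _ => ?_
              rw [← Finset.sum_mul, ← Finset.mul_sum, hp.sum_eq_one]
              ring
            · rw [Finset.sum_comm, Finset.mul_sum]
              refine Finset.sum_congr rfl fun x' _ => ?_
              rw [← Finset.sum_mul, hp.marginal]
              ring
    rw [klSum_prod hν₁ hac₁, klSum_prod hν₂ hac₂]
    linarith

lemma WeakTransportIneq.of_equiv {a b : ℝ} {μ : X → ℝ} {d : ι → X → X → ℝ} (e : Y ≃ X)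
    (f : κ ≃ ι) (h : WeakTransportIneq a b μ d) :
    WeakTransportIneq a b (fun y => μ (e y)) (fun j y y' => d (f j) (e y) (e y')) := by
  intro ν₁ hν₁ ν₂ hν₂ hac₁ hac₂
  have hmem : ∀ {ν : Y → ℝ}, ν ∈ stdSimplex ℝ Y → (fun x => ν (e.symm x)) ∈ stdSimplex ℝ X :=
    fun hν => ⟨fun x => hν.1 _, by rw [← hν.2]; exact Equiv.sum_comp e.symm _⟩
  have hkl : ∀ ν : Y → ℝ, klSum (fun x => ν (e.symm x)) μ = klSum ν (fun y => μ (e y)) :=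
    fun ν => by
      unfold klSum
      rw [← Equiv.sum_comp e]
      simp
  obtain ⟨p, hp, hpd⟩ := h _ (hmem hν₁) _ (hmem hν₂)
    (fun x hx => hac₁ _ (by simpa using hx)) (fun x hx => hac₂ _ (by simpa using hx))
  refine ⟨fun y y' => p (e y) (e y'), ⟨fun y y' => hp.nonneg _ _, fun y => ?_, fun y => ?_⟩, ?_⟩
  · rw [← hp.sum_eq_one (e y)]
    exact Equiv.sum_comp e _
  · rw [← e.symm_apply_apply y, ← hp.marginal (e y), ← Equiv.sum_comp e]
    simp
  · rw [← hkl, ← hkl]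
    refine le_trans (le_of_eq ?_) hpd
    rw [← Equiv.sum_comp e]
    refine Finset.sum_congr rfl fun y _ => ?_
    rw [← Equiv.sum_comp f, e.symm_apply_apply]
    congr 1
    refine Finset.sum_congr rfl fun j _ => ?_
    congr 1
    exact Equiv.sum_comp e (fun x => p (e y) x * d (f j) (e y) x)

end Tensorization

lemma prod_mem_stdSimplex {A : Type*} [Fintype A] {m : ℕ} {ν : Fin m → A → ℝ}
    (hν : ∀ j, ν j ∈ stdSimplex ℝ A) :
    (fun x : Fin m → A => ∏ j, ν j (x j)) ∈ stdSimplex ℝ (Fin m → A) := by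
  refine ⟨fun x => Finset.prod_nonneg fun j _ => (hν j).1 _, ?_⟩
  rw [← Fintype.prod_sum]
  exact Finset.prod_eq_one fun j _ => (hν j).2

/-- Marton's inequality for product measures. -/
lemma weakTransportIneq_pi {A : Type*} [Fintype A] {θ : ℝ} (hθ : 0 < θ) :
    ∀ {m : ℕ} {ν : Fin m → A → ℝ}, (∀ j, ν j ∈ stdSimplex ℝ A) →
      WeakTransportIneq (2 * (1 + θ)) (2 * (1 + θ⁻¹)) (fun x : Fin m → A => ∏ j, ν j (x j))
        (fun j x y => if x j = y j then (0 : ℝ) else 1)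
  | 0, ν, hν => by
    intro ν₁ hν₁ ν₂ hν₂ hac₁ hac₂
    have hθi : 0 < θ⁻¹ := inv_pos.2 hθ
    have h1 := klSum_nonneg hν₁ (prod_mem_stdSimplex hν) hac₁
    have h2 := klSum_nonneg hν₂ (prod_mem_stdSimplex hν) hac₂
    refine ⟨fun _ y => ν₂ y, ⟨fun _ y => hν₂.1 y, fun _ => hν₂.2, fun y => ?_⟩, ?_⟩
    · rw [← Finset.sum_mul, hν₁.2, one_mul]
    · simp only [Finset.univ_eq_empty, Finset.sum_empty, mul_zero, Finset.sum_const_zero]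
      positivity
  | m + 1, ν, hν => by
    have h := ((weakTransportIneq_discrete hθ (hν 0)).prod
      (prod_mem_stdSimplex fun j : Fin m => hν j.succ)
      (weakTransportIneq_pi hθ fun j : Fin m => hν j.succ)).of_equiv
      (Fin.consEquiv fun _ : Fin (m + 1) => A).symm
      ((finSuccEquiv m).trans ((Equiv.optionEquivSumPUnit (Fin m)).trans (Equiv.sumComm _ _)))
    convert h using 1
    · funext x
      rw [Fin.prod_univ_succ]
      rfl
    · funext j x y
      refine Fin.cases ?_ (fun j => ?_) j
      · simp [Fin.consEquiv]
      · simp [Fin.consEquiv, Fin.tail]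
        congr

/-! ### Push-forward of transports -/

/-- The push-forward of a density on a finite space. -/
def pushDensity {P X : Type*} [Fintype P] (U : P → X) (ν : P → ℝ) (σ : X) : ℝ :=
  ∑ x, if U x = σ then ν x else 0

section Push

variable {P X : Type*} [Fintype P] [Fintype X]

lemma sum_pushDensity_mul (U : P → X) (ν : P → ℝ) (f : X → ℝ) :
    ∑ σ, pushDensity U ν σ * f σ = ∑ x, ν x * f (U x) := by
  simp only [pushDensity, Finset.sum_mul]
  rw [Finset.sum_comm]
  refine Finset.sum_congr rfl fun x _ => ?_
  simp [ite_mul]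

lemma pushDensity_mem_stdSimplex (U : P → X) {ν : P → ℝ} (hν : ν ∈ stdSimplex ℝ P) :
    pushDensity U ν ∈ stdSimplex ℝ X := by
  refine ⟨fun σ => Finset.sum_nonneg fun x _ => ?_, ?_⟩
  · split_ifs
    exacts [hν.1 x, le_rfl]
  · simpa [hν.2] using sum_pushDensity_mul U ν fun _ => 1

lemma IsTransport.exists_push (U : P → X) {ν₁ ν₂ : P → ℝ} {p : P → P → ℝ}
    (hν₁ : ν₁ ∈ stdSimplex ℝ P) (hν₂ : ν₂ ∈ stdSimplex ℝ P) (hp : IsTransport ν₁ ν₂ p) :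
    ∃ q, IsTransport (pushDensity U ν₁) (pushDensity U ν₂) q ∧
      ∀ d : X → X → ℝ, ∑ σ, pushDensity U ν₁ σ * (∑ τ, q σ τ * d σ τ) ^ 2 ≤
        ∑ x, ν₁ x * (∑ y, p x y * d (U x) (U y)) ^ 2 := by
  have hm₁ := pushDensity_mem_stdSimplex U hν₁
  have hm₂ := pushDensity_mem_stdSimplex U hν₂
  have hps : ∀ x, p x ∈ stdSimplex ℝ P := fun x => ⟨hp.nonneg x, hp.sum_eq_one x⟩
  let w : X → P → ℝ := fun σ x => (if U x = σ then ν₁ x else 0) / pushDensity U ν₁ σ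
  have hw : ∀ σ, pushDensity U ν₁ σ ≠ 0 → w σ ∈ stdSimplex ℝ P := fun σ h => by
    refine ⟨fun x => div_nonneg ?_ (hm₁.1 σ), ?_⟩
    · split_ifs
      exacts [hν₁.1 x, le_rfl]
    · simp only [w]
      rw [← Finset.sum_div]
      exact div_self h
  have hmw : ∀ σ x, pushDensity U ν₁ σ ≠ 0 →
      pushDensity U ν₁ σ * w σ x = if U x = σ then ν₁ x else 0 :=
    fun σ x h => mul_div_cancel₀ _ h
  have hzero : ∀ σ, pushDensity U ν₁ σ = 0 → ∀ x, (if U x = σ then ν₁ x else 0) = 0 :=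
    fun σ h x => (Finset.sum_eq_zero_iff_of_nonneg fun x _ => by
      split_ifs
      exacts [hν₁.1 x, le_rfl]).1 h x (Finset.mem_univ x)
  let q : X → X → ℝ := fun σ τ =>
    if pushDensity U ν₁ σ = 0 then pushDensity U ν₂ τ else ∑ x, w σ x * pushDensity U (p x) τ
  have hq : ∀ σ τ, pushDensity U ν₁ σ * q σ τ =
      ∑ x, (if U x = σ then ν₁ x else 0) * pushDensity U (p x) τ := fun σ τ => by
    by_cases h : pushDensity U ν₁ σ = 0
    · simp only [hzero σ h, zero_mul, Finset.sum_const_zero, h]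
    · simp only [q, if_neg h, Finset.mul_sum, ← mul_assoc, hmw σ _ h]
  refine ⟨q, ⟨fun σ τ => ?_, fun σ => ?_, fun τ => ?_⟩, fun d => ?_⟩
  · simp only [q]
    split_ifs with h
    · exact hm₂.1 τ
    · exact Finset.sum_nonneg fun x _ =>
        mul_nonneg ((hw σ h).1 x) ((pushDensity_mem_stdSimplex U (hps x)).1 τ)
  · by_cases h : pushDensity U ν₁ σ = 0
    · simp only [q, if_pos h, hm₂.2]
    · simp only [q, if_neg h]
      rw [Finset.sum_comm]
      simp only [← Finset.mul_sum, (pushDensity_mem_stdSimplex U (hps _)).2, mul_one, (hw σ h).2]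
  · simp only [hq]
    rw [Finset.sum_comm]
    simp only [← Finset.sum_mul, Finset.sum_ite_eq, Finset.mem_univ, if_true]
    simp only [pushDensity, Finset.mul_sum]
    rw [Finset.sum_comm]
    refine Finset.sum_congr rfl fun y _ => ?_
    split_ifs
    · exact hp.marginal y
    · simp
  · have hstep : ∀ σ, pushDensity U ν₁ σ * (∑ τ, q σ τ * d σ τ) ^ 2 ≤
        ∑ x, if U x = σ then ν₁ x * (∑ y, p x y * d (U x) (U y)) ^ 2 else 0 := fun σ => by
      by_cases h : pushDensity U ν₁ σ = 0
      · rw [h, zero_mul]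
        refine Finset.sum_nonneg fun x _ => ?_
        split_ifs
        exacts [mul_nonneg (hν₁.1 x) (sq_nonneg _), le_rfl]
      · have h1 : ∑ τ, q σ τ * d σ τ = ∑ x, w σ x * ∑ y, p x y * d σ (U y) := by
          simp only [q, if_neg h, Finset.sum_mul]
          rw [Finset.sum_comm]
          refine Finset.sum_congr rfl fun x _ => ?_
          rw [← sum_pushDensity_mul U (p x) (d σ), Finset.mul_sum]
          simp only [mul_assoc]
        rw [h1]
        refine (mul_le_mul_of_nonneg_left (sq_sum_mul_le (hw σ h) _) (hm₁.1 σ)).trans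
          (le_of_eq ?_)
        rw [Finset.mul_sum]
        refine Finset.sum_congr rfl fun x _ => ?_
        rw [← mul_assoc, hmw σ x h]
        split_ifs with hx
        · rw [hx]
        · rw [zero_mul]
    refine (Finset.sum_le_sum fun σ _ => hstep σ).trans (le_of_eq ?_)
    rw [Finset.sum_comm]
    simp

/-- A density which is absolutely continuous with respect to a push-forward lifts to a density
with the same relative entropy. -/
lemma exists_lift (U : P → X) {μ : P → ℝ} (hμ : μ ∈ stdSimplex ℝ P) {ν : X → ℝ}
    (hν : ν ∈ stdSimplex ℝ X) (hac : ∀ σ, pushDensity U μ σ = 0 → ν σ = 0) :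
    ∃ ν' ∈ stdSimplex ℝ P, (∀ x, μ x = 0 → ν' x = 0) ∧ pushDensity U ν' = ν ∧
      klSum ν' μ = klSum ν (pushDensity U μ) := by
  have hm := pushDensity_mem_stdSimplex U hμ
  have hmul : ∀ σ, pushDensity U μ σ * (ν σ / pushDensity U μ σ) = ν σ := fun σ => by
    by_cases h : pushDensity U μ σ = 0
    · rw [h, hac σ h, zero_mul]
    · exact mul_div_cancel₀ _ h
  refine ⟨fun x => μ x * (ν (U x) / pushDensity U μ (U x)),
    ⟨fun x => mul_nonneg (hμ.1 x) (div_nonneg (hν.1 _) (hm.1 _)), ?_⟩,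
    fun x hx => mul_eq_zero_of_left hx _, funext fun σ => ?_, ?_⟩
  · rw [← sum_pushDensity_mul U μ fun σ => ν σ / pushDensity U μ σ]
    simp only [hmul, hν.2]
  · rw [← hmul σ]
    simp only [pushDensity, Finset.sum_mul]
    refine Finset.sum_congr rfl fun x _ => ?_
    split_ifs with h
    · rw [← h]
    · rw [zero_mul]
  · unfold klSum
    have h : ∀ σ, ν σ * Real.log (ν σ / pushDensity U μ σ) = pushDensity U μ σ *
        (ν σ / pushDensity U μ σ * Real.log (ν σ / pushDensity U μ σ)) := fun σ => by
      rw [← mul_assoc, hmul]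
    simp only [h]
    rw [sum_pushDensity_mul U μ fun σ =>
      ν σ / pushDensity U μ σ * Real.log (ν σ / pushDensity U μ σ)]
    refine Finset.sum_congr rfl fun x _ => ?_
    by_cases hx : μ x = 0
    · simp [hx]
    · rw [mul_div_cancel_left₀ _ hx, mul_assoc]

end Push

/-! ### Hamming distance and local bases -/

lemma dH_nonneg {n : ℕ} (σ τ : Equiv.Perm (Fin n)) : 0 ≤ dH σ τ := Nat.cast_nonneg _

lemma dH_self {n : ℕ} (σ : Equiv.Perm (Fin n)) : dH σ σ = 0 := by simp [dH]

lemma dH_triangle {n : ℕ} (σ τ ρ : Equiv.Perm (Fin n)) : dH σ ρ ≤ dH σ τ + dH τ ρ := by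
  unfold dH
  rw [← Nat.cast_add, Nat.cast_le]
  refine (Finset.card_le_card ?_).trans (Finset.card_union_le _ _)
  intro i
  simp only [Finset.mem_filter, Finset.mem_univ, true_and, Finset.mem_union]
  intro h
  by_contra! h'
  exact h (h'.1.trans h'.2)

lemma dH_mul_left {n : ℕ} (ρ σ τ : Equiv.Perm (Fin n)) : dH (ρ * σ) (ρ * τ) = dH σ τ := by
  simp [dH]

lemma dH_mul_right {n : ℕ} (σ τ ρ : Equiv.Perm (Fin n)) : dH (σ * ρ) (τ * ρ) = dH σ τ := by
  unfold dH
  congr 1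
  refine Finset.card_equiv ρ fun i => ?_
  rw [Finset.mem_filter, Finset.mem_filter]
  simp

lemma dH_mul_mul_le {n : ℕ} (σ σ' τ τ' : Equiv.Perm (Fin n)) :
    dH (σ * τ) (σ' * τ') ≤ dH σ σ' + dH τ τ' := by
  have h := dH_triangle (σ * τ) (σ' * τ) (σ' * τ')
  rwa [dH_mul_right, dH_mul_left] at h

lemma dH_one_right {n : ℕ} (σ : Equiv.Perm (Fin n)) : dH σ 1 = degree σ := by
  unfold dH degree
  congr 2

lemma dH_one_left {n : ℕ} (σ : Equiv.Perm (Fin n)) : dH 1 σ = degree σ := by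
  unfold dH degree
  congr 2
  ext i
  rw [Finset.mem_filter, Finset.mem_filter, Equiv.Perm.one_apply, ne_comm]

lemma dH_list_prod_le {n : ℕ} {α : Type*} (f g : α → Equiv.Perm (Fin n)) (l : List α) :
    dH (l.map f).prod (l.map g).prod ≤ (l.map fun a => dH (f a) (g a)).sum := by
  induction l with
  | nil => simp [dH_self]
  | cons a l ih =>
    simp only [List.map_cons, List.prod_cons, List.sum_cons]
    exact (dH_mul_mul_le _ _ _ _).trans (by gcongr)

/-- The Lipschitz constant of `UT` for an `ℓ`-local base. -/
def lipConst (n ℓ : ℕ) : ℝ := min (2 * (ℓ : ℝ) - 1) (n : ℝ)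

lemma dH_le_card {n : ℕ} (σ τ : Equiv.Perm (Fin n)) : dH σ τ ≤ n := by
  unfold dH
  rw [Nat.cast_le]
  exact (Finset.card_le_univ _).trans_eq (Fintype.card_fin n)

lemma dH_le_of_common_support {n ℓ : ℕ} {σ τ : Equiv.Perm (Fin n)} (hσ : degree σ ≤ ℓ)
    (hτ : degree τ ≤ ℓ) {j : Fin n} (hσj : σ j ≠ j) (hτj : τ j ≠ j) :
    dH σ τ ≤ 2 * (ℓ : ℝ) - 1 := by
  unfold degree at hσ hτ
  set s := Finset.univ.filter fun i => σ i ≠ i with hs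
  set s' := Finset.univ.filter fun i => τ i ≠ i with hs'
  have hsub : (Finset.univ.filter fun i => σ i ≠ τ i) ⊆ s ∪ s' := by
    intro i
    simp only [hs, hs', Finset.mem_filter, Finset.mem_univ, true_and, Finset.mem_union]
    intro h
    by_contra! h'
    exact h (h'.1.trans h'.2.symm)
  have hj : 0 < (s ∩ s').card := Finset.card_pos.2 ⟨j, by simp [hs, hs', hσj, hτj]⟩
  have hle := Finset.card_le_card hsub
  have hui := Finset.card_union_add_card_inter s s'
  have hfin : (Finset.univ.filter fun i => σ i ≠ τ i).card + 1 ≤ 2 * ℓ := by omega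
  unfold dH
  have : (((Finset.univ.filter fun i => σ i ≠ τ i).card + 1 : ℕ) : ℝ) ≤ ((2 * ℓ : ℕ) : ℝ) :=
    Nat.cast_le.2 hfin
  push_cast at this
  linarith

section LocalBase

variable {n ℓ : ℕ} {G : Subgroup (Equiv.Perm (Fin n))} {t : Fin n → Fin n → Equiv.Perm (Fin n)}

lemma mem_orb_self (j : Fin n) : j ∈ Orb G j :=
  ⟨1, ⟨G.one_mem, fun _ _ => rfl⟩, rfl⟩

lemma IsLocalBase.apply_ne {j : Fin n} (hj : (j : ℕ) ≠ 0) (ht : IsLocalBase ℓ G t) {i : Fin n}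
    (hi : i ∈ Orb G j) (hij : i ≠ j) : t i j j ≠ j := fun h =>
  hij ((t i j).injective (((ht j hj).2 i hi hij).2.1.trans h.symm))

lemma IsLocalBase.degree_le {j : Fin n} (hj : (j : ℕ) ≠ 0) (ht : IsLocalBase ℓ G t) {i : Fin n}
    (hi : i ∈ Orb G j) : degree (t i j) ≤ ℓ := by
  by_cases hij : i = j
  · rw [hij, (ht j hj).1]
    simp [degree]
  · exact ((ht j hj).2 i hi hij).2.2

lemma IsLocalBase.dH_le {j : Fin n} (hj : (j : ℕ) ≠ 0) (ht : IsLocalBase ℓ G t) (hℓ : 2 ≤ ℓ)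
    {i i' : Fin n} (hi : i ∈ Orb G j) (hi' : i' ∈ Orb G j) :
    dH (t i j) (t i' j) ≤ lipConst n ℓ := by
  refine le_min ?_ (dH_le_card _ _)
  have hℓ' : (2 : ℝ) ≤ ℓ := by exact_mod_cast hℓ
  by_cases hij : i = j
  · have h : dH (t i j) (t i' j) = degree (t i' j) := by
      rw [hij, (ht j hj).1, dH_one_left]
    have h' : (degree (t i' j) : ℝ) ≤ ℓ := by exact_mod_cast ht.degree_le hj hi'
    linarith
  by_cases hij' : i' = j
  · have h : dH (t i j) (t i' j) = degree (t i j) := by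
      rw [hij', (ht j hj).1, dH_one_right]
    have h' : (degree (t i j) : ℝ) ≤ ℓ := by exact_mod_cast ht.degree_le hj hi
    linarith
  exact dH_le_of_common_support (ht.degree_le hj hi) (ht.degree_le hj hi')
    (ht.apply_ne hj hi hij) (ht.apply_ne hj hi' hij')

lemma lipConst_pos (hn : 2 ≤ n) (hℓ : 2 ≤ ℓ) : 0 < lipConst n ℓ := by
  have hn' : (2 : ℝ) ≤ n := by exact_mod_cast hn
  have hℓ' : (2 : ℝ) ≤ ℓ := by exact_mod_cast hℓ
  exact lt_min (by linarith) (by linarith)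

lemma ne_zero_of_mem_drop_one {j : Fin n} (hj : j ∈ (List.finRange n).drop 1) : (j : ℕ) ≠ 0 := by
  obtain ⟨k, hk, rfl⟩ := List.getElem_of_mem hj
  simp

lemma IsLocalBase.dH_UT_le (ht : IsLocalBase ℓ G t) (hn : 2 ≤ n) (hℓ : 2 ≤ ℓ) {x y : Fin n → Fin n}
    (hx : ∀ j, x j ∈ Orb G j) (hy : ∀ j, y j ∈ Orb G j) :
    dH (UT t x) (UT t y) ≤ lipConst n ℓ *
      ∑ j ∈ Finset.univ.filter (fun j : Fin n => (j : ℕ) ≠ 0 ∧ Orb G j ≠ {j}),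
        if x j = y j then (0 : ℝ) else 1 := by
  have hc := (lipConst_pos hn hℓ).le
  refine (dH_list_prod_le _ _ _).trans ?_
  have hnd : ((List.finRange n).drop 1).Nodup := (List.nodup_finRange n).sublist
    (List.drop_sublist _ _)
  rw [← List.sum_toFinset _ hnd, Finset.sum_filter, Finset.mul_sum]
  have hterm : ∀ j ∈ ((List.finRange n).drop 1).toFinset, dH (t (x j) j) (t (y j) j) ≤
      lipConst n ℓ * if (j : ℕ) ≠ 0 ∧ Orb G j ≠ {j} then if x j = y j then 0 else 1 else 0 := by
    intro j hj
    have hj0 := ne_zero_of_mem_drop_one (List.mem_toFinset.1 hj)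
    by_cases hxy : x j = y j
    · simp [hxy, dH_self]
    have horb : Orb G j ≠ {j} := fun h => by
      have h1 := hx j
      have h2 := hy j
      rw [h] at h1 h2
      exact hxy (h1.trans h2.symm)
    rw [if_pos ⟨hj0, horb⟩, if_neg hxy, mul_one]
    exact ht.dH_le hj0 hℓ (hx j) (hy j)
  refine (Finset.sum_le_sum hterm).trans ?_
  refine Finset.sum_le_sum_of_subset_of_nonneg (Finset.subset_univ _) fun j _ _ => ?_
  refine mul_nonneg hc ?_
  split_ifs <;> norm_num

lemma eq_one_of_Kn_eq_zero (hK : Kn G = 0) {σ : Equiv.Perm (Fin n)} (hσ : σ ∈ G) : σ = 1 := by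
  have horb : ∀ j : Fin n, (j : ℕ) ≠ 0 → Orb G j = {j} := fun j hj => by
    unfold Kn at hK
    rw [Finset.card_eq_zero, Finset.filter_eq_empty_iff] at hK
    by_contra h
    exact hK (Finset.mem_univ j) ⟨hj, h⟩
  by_contra hne
  have hs : (Finset.univ.filter fun i => σ i ≠ i).Nonempty := by
    obtain ⟨i, hi⟩ := not_forall.1 fun h => hne (Equiv.ext h)
    exact ⟨i, by simpa using hi⟩
  obtain ⟨j, hj, hmax⟩ := Finset.exists_max_image _ id hs
  simp only [Finset.mem_filter, Finset.mem_univ, true_and, id] at hj hmax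
  have hfix : ∀ i, j < i → σ i = i := fun i hi => by
    by_contra h
    exact absurd (hmax i h) (not_le.2 hi)
  have hmem : σ j ∈ Orb G j := ⟨σ, ⟨hσ, hfix⟩, rfl⟩
  by_cases hj0 : (j : ℕ) = 0
  · have hlt : j < σ j := by
      refine lt_of_le_of_ne ?_ (Ne.symm hj)
      rw [Fin.le_def, hj0]
      exact Nat.zero_le _
    exact hj (σ.injective (hfix _ hlt))
  · rw [horb j hj0] at hmem
    exact hj hmem

end LocalBase

lemma tT2_le {X : Type*} [Fintype X] (d : X → X → ℝ) {ν₁ ν₂ : X → ℝ} (hν₁ : ∀ x, 0 ≤ ν₁ x)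
    {p : X → X → ℝ} (hp : IsTransport ν₁ ν₂ p) :
    tT2 d ν₁ ν₂ ≤ ∑ x, ν₁ x * (∑ y, p x y * d x y) ^ 2 := by
  refine csInf_le ⟨0, ?_⟩ ⟨p, hp.nonneg, hp.sum_eq_one, hp.marginal, rfl⟩
  rintro w ⟨q, -, -, -, rfl⟩
  exact Finset.sum_nonneg fun x _ => mul_nonneg (hν₁ x) (sq_nonneg _)

lemma IsProbOn.mem_stdSimplex {X : Type*} [Fintype X] {ν : X → ℝ} {S : Set X}
    (hν : IsProbOn ν S) : ν ∈ stdSimplex ℝ X := ⟨hν.1, hν.2.2⟩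

lemma tT2_nonpos_of_Kn_eq_zero {n : ℕ} {G : Subgroup (Equiv.Perm (Fin n))} (hK : Kn G = 0)
    {ν₁ ν₂ : Equiv.Perm (Fin n) → ℝ} (hν₁ : IsProbOn ν₁ (G : Set (Equiv.Perm (Fin n))))
    (hν₂ : IsProbOn ν₂ (G : Set (Equiv.Perm (Fin n)))) : tT2 dH ν₁ ν₂ ≤ 0 := by
  have hp : IsTransport ν₁ ν₂ fun _ τ => ν₂ τ :=
    ⟨fun _ τ => hν₂.1 τ, fun _ => hν₂.2.2, fun τ => by rw [← Finset.sum_mul, hν₁.2.2, one_mul]⟩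
  refine (tT2_le dH hν₁.1 hp).trans (Finset.sum_nonpos fun σ _ => le_of_eq ?_)
  by_cases hσ : σ ∈ G
  · have h : ∑ τ, ν₂ τ * dH σ τ = 0 := Finset.sum_eq_zero fun τ _ => by
      by_cases hτ : τ ∈ G
      · rw [eq_one_of_Kn_eq_zero hK hσ, eq_one_of_Kn_eq_zero hK hτ, dH_self, mul_zero]
      · rw [hν₂.2.1 τ hτ, zero_mul]
    rw [h]
    ring
  · rw [hν₁.2.1 σ hσ, zero_mul]

lemma MemMT.exists_pushDensity_eq {n : ℕ} {G : Subgroup (Equiv.Perm (Fin n))}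
    {t : Fin n → Fin n → Equiv.Perm (Fin n)} {μ : Equiv.Perm (Fin n) → ℝ} (hμ : MemMT G t μ) :
    ∃ νh : Fin n → Fin n → ℝ, (∀ j, νh j ∈ stdSimplex ℝ (Fin n)) ∧
      (∀ j, ∀ i ∉ Orb G j, νh j i = 0) ∧
      μ = pushDensity (UT t) fun x => ∏ j, νh j (x j) := by
  obtain ⟨νh, hνh, hμ⟩ := hμ
  exact ⟨νh, fun j => ⟨(hνh j).1, (hνh j).2.2⟩, fun j => (hνh j).2.1, funext fun σ => by
    rw [hμ σ]
    unfold pushDensity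
    congr!⟩

lemma MemMT.mem_stdSimplex {n : ℕ} {G : Subgroup (Equiv.Perm (Fin n))}
    {t : Fin n → Fin n → Equiv.Perm (Fin n)} {μ : Equiv.Perm (Fin n) → ℝ} (hμ : MemMT G t μ) :
    μ ∈ stdSimplex ℝ (Equiv.Perm (Fin n)) := by
  obtain ⟨νh, hνs, -, rfl⟩ := hμ.exists_pushDensity_eq
  exact pushDensity_mem_stdSimplex _ (prod_mem_stdSimplex hνs)

/-- The transport-entropy inequality for the class `M_T`, in terms of real relative entropies. -/
lemma tT2_le_of_memMT {n ℓ : ℕ} (hn : 2 ≤ n) (hℓ : 2 ≤ ℓ)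
    {G : Subgroup (Equiv.Perm (Fin n))} {t : Fin n → Fin n → Equiv.Perm (Fin n)}
    (ht : IsLocalBase ℓ G t) {μ : Equiv.Perm (Fin n) → ℝ} (hμ : MemMT G t μ)
    {ν₁ ν₂ : Equiv.Perm (Fin n) → ℝ} (hν₁ : ν₁ ∈ stdSimplex ℝ (Equiv.Perm (Fin n)))
    (hν₂ : ν₂ ∈ stdSimplex ℝ (Equiv.Perm (Fin n)))
    (hac₁ : ∀ σ, μ σ = 0 → ν₁ σ = 0) (hac₂ : ∀ σ, μ σ = 0 → ν₂ σ = 0)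
    {θ : ℝ} (hθ : 0 < θ) :
    tT2 dH ν₁ ν₂ ≤ lipConst n ℓ ^ 2 * Kn G *
      (2 * (1 + θ) * klSum ν₁ μ + 2 * (1 + θ⁻¹) * klSum ν₂ μ) := by
  obtain ⟨νh, hνs, hνh, rfl⟩ := hμ.exists_pushDensity_eq
  set μ' : (Fin n → Fin n) → ℝ := fun x => ∏ j, νh j (x j)
  have hμs : μ' ∈ stdSimplex ℝ (Fin n → Fin n) := prod_mem_stdSimplex hνs
  have hsupp : ∀ x, μ' x ≠ 0 → ∀ j, x j ∈ Orb G j := fun x hx j => by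
    by_contra h
    exact hx (Finset.prod_eq_zero (Finset.mem_univ j) (hνh j _ h))
  obtain ⟨ν₁', hν₁', hac₁', rfl, hkl₁⟩ := exists_lift (UT t) hμs hν₁ hac₁
  obtain ⟨ν₂', hν₂', hac₂', rfl, hkl₂⟩ := exists_lift (UT t) hμs hν₂ hac₂
  obtain ⟨p, hp, hpd⟩ := weakTransportIneq_pi hθ hνs ν₁' hν₁' ν₂' hν₂' hac₁' hac₂'
  obtain ⟨q, hq, hqd⟩ := hp.exists_push (UT t) hν₁' hν₂'
  refine (tT2_le dH hν₁.1 hq).trans ((hqd dH).trans ?_)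
  rw [← hkl₁, ← hkl₂]
  refine le_trans ?_ (mul_le_mul_of_nonneg_left hpd
    (mul_nonneg (sq_nonneg _) (Nat.cast_nonneg (Kn G))))
  rw [Finset.mul_sum]
  refine Finset.sum_le_sum fun x _ => ?_
  rcases (hν₁'.1 x).eq_or_lt with hx0 | hx0
  · simp [← hx0]
  have hxorb := hsupp x fun h => hx0.ne' (hac₁' x h)
  set S := Finset.univ.filter (fun j : Fin n => (j : ℕ) ≠ 0 ∧ Orb G j ≠ {j}) with hS
  have hlip : ∑ y, p x y * dH (UT t x) (UT t y) ≤
      lipConst n ℓ * ∑ j ∈ S, ∑ y, p x y * (if x j = y j then 0 else 1) := by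
    rw [Finset.sum_comm, Finset.mul_sum]
    refine Finset.sum_le_sum fun y _ => ?_
    rw [← Finset.mul_sum, mul_left_comm]
    by_cases hy : μ' y = 0
    · have h := hp.mul_apply_eq_zero hν₁'.1 (hac₂' y hy) x
      rw [(mul_eq_zero.1 h).resolve_left hx0.ne', zero_mul, zero_mul]
    · exact mul_le_mul_of_nonneg_left (ht.dH_UT_le hn hℓ hxorb (hsupp y hy)) (hp.nonneg x y)
  have hnn : 0 ≤ ∑ y, p x y * dH (UT t x) (UT t y) :=
    Finset.sum_nonneg fun y _ => mul_nonneg (hp.nonneg x y) (dH_nonneg _ _)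
  rw [mul_left_comm]
  refine mul_le_mul_of_nonneg_left ?_ hx0.le
  calc (∑ y, p x y * dH (UT t x) (UT t y)) ^ 2
      ≤ (lipConst n ℓ * ∑ j ∈ S, ∑ y, p x y * (if x j = y j then 0 else 1)) ^ 2 := by gcongr
    _ ≤ lipConst n ℓ ^ 2 *
        (Kn G * ∑ j ∈ S, (∑ y, p x y * (if x j = y j then 0 else 1)) ^ 2) := by
      rw [mul_pow]
      gcongr
      exact sq_sum_le_card_mul_sum_sq
    _ ≤ _ := by
      rw [mul_assoc]
      have h := Finset.sum_le_sum_of_subset_of_nonneg (Finset.subset_univ S)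
        fun j _ _ => sq_nonneg (∑ y, p x y * (if x j = y j then (0 : ℝ) else 1))
      gcongr
      convert h

/-- Transport-entropy inequality for the weak cost `̃T₂` and measures of the class
`M_T`. -/
theorem stmt5 {n ℓ : ℕ} (hn : 2 ≤ n) (hℓ : 2 ≤ ℓ) (hℓn : ℓ ≤ n)
    (G : Subgroup (Equiv.Perm (Fin n))) (t : Fin n → Fin n → Equiv.Perm (Fin n))
    (ht : IsLocalBase ℓ G t) (μ : Equiv.Perm (Fin n) → ℝ) (hμ : MemMT G t μ)
    (ν₁ ν₂ : Equiv.Perm (Fin n) → ℝ)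
    (hν₁ : IsProbOn ν₁ (G : Set (Equiv.Perm (Fin n))))
    (hν₂ : IsProbOn ν₂ (G : Set (Equiv.Perm (Fin n)))) :
    ENNReal.ofReal (tT2 dH ν₁ ν₂) ≤
      ENNReal.ofReal (2 * (min (2 * (ℓ : ℝ) - 1) (n : ℝ)) ^ 2 * (Kn G : ℝ)) *
        (relEnt ν₁ μ ^ ((1 : ℝ) / 2) + relEnt ν₂ μ ^ ((1 : ℝ) / 2)) ^ 2 := by
  have hc := lipConst_pos hn hℓ
  change _ ≤ ENNReal.ofReal (2 * lipConst n ℓ ^ 2 * (Kn G : ℝ)) * _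
  rcases Nat.eq_zero_or_pos (Kn G) with hK | hK
  · rw [ENNReal.ofReal_of_nonpos (tT2_nonpos_of_Kn_eq_zero hK hν₁ hν₂)]
    exact zero_le
  have hK' : (0 : ℝ) < Kn G := Nat.cast_pos.2 hK
  have hcoef : ENNReal.ofReal (2 * lipConst n ℓ ^ 2 * (Kn G : ℝ)) ≠ 0 :=
    (ENNReal.ofReal_pos.2 (by positivity)).ne'
  have hhalf : (0 : ℝ) < 1 / 2 := by norm_num
  by_cases hac₁ : ∀ σ, μ σ = 0 → ν₁ σ = 0
  swap
  · have h : relEnt ν₁ μ = ⊤ := if_neg hac₁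
    rw [h, ENNReal.top_rpow_of_pos hhalf, top_add, ENNReal.top_pow two_ne_zero,
      ENNReal.mul_top hcoef]
    exact le_top
  by_cases hac₂ : ∀ σ, μ σ = 0 → ν₂ σ = 0
  swap
  · have h : relEnt ν₂ μ = ⊤ := if_neg hac₂
    rw [h, ENNReal.top_rpow_of_pos hhalf, add_top, ENNReal.top_pow two_ne_zero,
      ENNReal.mul_top hcoef]
    exact le_top
  have hμs := hμ.mem_stdSimplex
  have h1 := klSum_nonneg hν₁.mem_stdSimplex hμs hac₁
  have h2 := klSum_nonneg hν₂.mem_stdSimplex hμs hac₂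
  have hr₁ : relEnt ν₁ μ = ENNReal.ofReal (klSum ν₁ μ) := if_pos hac₁
  have hr₂ : relEnt ν₂ μ = ENNReal.ofReal (klSum ν₂ μ) := if_pos hac₂
  rw [hr₁, hr₂, ENNReal.ofReal_rpow_of_nonneg h1 hhalf.le,
    ENNReal.ofReal_rpow_of_nonneg h2 hhalf.le, ← Real.sqrt_eq_rpow, ← Real.sqrt_eq_rpow,
    ← ENNReal.ofReal_add (Real.sqrt_nonneg _) (Real.sqrt_nonneg _),
    ← ENNReal.ofReal_pow (by positivity), ← ENNReal.ofReal_mul (by positivity)]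
  refine ENNReal.ofReal_le_ofReal ?_
  rw [← div_le_iff₀' (by positivity)]
  refine le_sq_sqrt_add_sqrt h1 h2 fun θ hθ => ?_
  rw [div_le_iff₀' (by positivity)]
  refine (tT2_le_of_memMT hn hℓ ht hμ hν₁.mem_stdSimplex hν₂.mem_stdSimplex hac₁ hac₂ hθ).trans
    (le_of_eq ?_)
  ring

end
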